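/- Let X be a finite set of N distinct points in R^n with similarity matrix A = Z_X, and let Y be a nonempty proper subset of X with N_Y points. Then the trace of the Schur complement S = A_Y - A_{Y,Y^c} (A_{Y^c})^{-1} (A_{Y,Y^c})^T of A_{Y^c} in A satisfies 0 < tr(S) < N_Y. -/

import Mathlib

open Matrix

/-- The similarity matrix of a family of points in Euclidean space:
entries `exp (-‖xᵢ - xⱼ‖)`. -/
noncomputable def simMatrix {m : Type*} {n : ℕ} (x : m → EuclideanSpace ℝ (Fin n)) :
    Matrix m m ℝ :=
  Matrix.of fun i j => Real.exp (-dist (x i) (x j))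

/-- The Schur complement of the principal submatrix `A_{Pᶜ}` in `A`:
`A/A_{Pᶜ} = A_P - A_{P,Pᶜ} (A_{Pᶜ})⁻¹ (A_{P,Pᶜ})ᵀ`. -/
noncomputable def schurCompl {N : ℕ} (A : Matrix (Fin N) (Fin N) ℝ) (P : Finset (Fin N)) :
    Matrix ↥P ↥P ℝ :=
  A.submatrix ((↑) : ↥P → Fin N) ((↑) : ↥P → Fin N) -
    A.submatrix ((↑) : ↥P → Fin N) ((↑) : ↥Pᶜ → Fin N) *
      (A.submatrix ((↑) : ↥Pᶜ → Fin N) ((↑) : ↥Pᶜ → Fin N))⁻¹ *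
      (A.submatrix ((↑) : ↥P → Fin N) ((↑) : ↥Pᶜ → Fin N))ᵀ

theorem quad_eq {m : Type*} [Fintype m] (M : Matrix m m ℝ) (c : m → ℝ) :
    star c ⬝ᵥ (M *ᵥ c) = ∑ i, ∑ j, c i * c j * M i j := by
  simp only [dotProduct, mulVec, Pi.star_apply, star_trivial, Finset.mul_sum]
  refine Finset.sum_congr rfl fun i _ => Finset.sum_congr rfl fun j _ => by ring

theorem posSemidef_pow {m : Type*} [Fintype m] (G : Matrix m m ℝ) (hG : G.PosSemidef) (k : ℕ) :
    (Matrix.of fun i j => G i j ^ k).PosSemidef := by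
  induction k with
  | zero =>
    refine .of_dotProduct_mulVec_nonneg (by ext i j; simp) fun c => ?_
    rw [quad_eq]
    have : ∑ i, ∑ j, c i * c j * (Matrix.of fun i j => G i j ^ 0) i j = (∑ i, c i) * ∑ j, c j := by
      simp [Finset.sum_mul_sum]
    rw [this]
    exact mul_self_nonneg _
  | succ k ih =>
    have := ih.hadamard hG
    have he : (Matrix.of fun i j => G i j ^ (k + 1)) = (Matrix.of fun i j => G i j ^ k) ⊙ G := by
      ext i j
      simp [pow_succ]
    rw [he]
    exact this

theorem hasSum_quad_exp {m : Type*} [Fintype m] (G : Matrix m m ℝ) (c : m → ℝ) :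
    HasSum (fun k : ℕ => (∑ i, ∑ j, c i * c j * G i j ^ k) / (k.factorial : ℝ))
      (∑ i, ∑ j, c i * c j * Real.exp (G i j)) := by
  simp only [Finset.sum_div]
  refine hasSum_sum fun i _ => hasSum_sum fun j _ => ?_
  have h := (NormedSpace.expSeries_div_hasSum_exp (G i j)).mul_left (c i * c j)
  rw [← Real.exp_eq_exp_ℝ] at h
  simpa only [mul_div_assoc] using h

theorem quad_exp_nonneg {m : Type*} [Fintype m] (G : Matrix m m ℝ) (hG : G.PosSemidef)
    (c : m → ℝ) : 0 ≤ ∑ i, ∑ j, c i * c j * Real.exp (G i j) := by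
  refine (hasSum_quad_exp G c).nonneg fun k => div_nonneg ?_ (by positivity)
  have := (posSemidef_pow G hG k).dotProduct_mulVec_nonneg c
  rw [quad_eq] at this
  simpa using this

theorem quad_exp_pos {m : Type*} [Fintype m] (G : Matrix m m ℝ) (hG : G.PosSemidef)
    (hd : ∀ i j, i ≠ j → 0 < G i i + G j j - 2 * G i j)
    (c : m → ℝ) (hc : c ≠ 0) : 0 < ∑ i, ∑ j, c i * c j * Real.exp (G i j) := by
  classical
  refine lt_of_le_of_ne (quad_exp_nonneg G hG c) fun h0 => ?_
  have hs := hasSum_quad_exp G c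
  rw [← h0] at hs
  have hnn : ∀ k : ℕ, 0 ≤ (∑ i, ∑ j, c i * c j * G i j ^ k) / (k.factorial : ℝ) := by
    intro k
    refine div_nonneg ?_ (by positivity)
    have := (posSemidef_pow G hG k).dotProduct_mulVec_nonneg c
    rw [quad_eq] at this
    simpa using this
  have hz := (hasSum_zero_iff_of_nonneg hnn).1 hs
  have hk : ∀ k : ℕ, ∀ j, ∑ i, c i * G j i ^ k = 0 := by
    intro k j
    have h1 := congrFun hz k
    have h2 : ∑ i, ∑ j, c i * c j * G i j ^ k = 0 := by
      have : (k.factorial : ℝ) ≠ 0 := by positivity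
      simpa [this] using h1
    have h3 := ((posSemidef_pow G hG k).dotProduct_mulVec_zero_iff c).1 (by
      rw [quad_eq]; simpa using h2)
    have h4 := congrFun h3 j
    simp only [mulVec, dotProduct, Matrix.of_apply, Pi.zero_apply] at h4
    rw [← h4]
    exact Finset.sum_congr rfl fun i _ => mul_comm _ _
  have hp : ∀ p : Polynomial ℝ, ∀ j, ∑ i, c i * p.eval (G j i) = 0 := by
    intro p j
    simp only [Polynomial.eval_eq_sum_range, Finset.mul_sum]
    rw [Finset.sum_comm]
    refine Finset.sum_eq_zero fun k _ => ?_
    have := hk k j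
    calc ∑ i, c i * (p.coeff k * G j i ^ k) = p.coeff k * ∑ i, c i * G j i ^ k := by
          rw [Finset.mul_sum]; exact Finset.sum_congr rfl fun i _ => by ring
      _ = 0 := by rw [this, mul_zero]
  obtain ⟨i0, hi0⟩ := Function.ne_iff.1 hc
  obtain ⟨j, hj, hmax⟩ := Finset.exists_max_image (Finset.univ.filter fun i => c i ≠ 0)
    (fun i => G i i) ⟨i0, by simpa using hi0⟩
  have hj' : c j ≠ 0 := by simpa using hj
  have hne : ∀ i, i ≠ j → c i ≠ 0 → G j i ≠ G j j := by
    intro i hij hci he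
    have h1 := hd j i (Ne.symm hij)
    have h2 := hmax i (by simpa using hci)
    rw [he] at h1
    linarith
  set s := (Finset.univ.filter fun i => c i ≠ 0).erase j with hsdef
  have h := hp (∏ i ∈ s, (Polynomial.X - Polynomial.C (G j i))) j
  rw [Finset.sum_eq_single j] at h
  · rw [mul_eq_zero, Polynomial.eval_prod, Finset.prod_eq_zero_iff] at h
    rcases h with h | ⟨i, hi, h⟩
    · exact hj' h
    · simp [hsdef] at hi h
      exact hne i hi.1 hi.2 (by linarith)
  · intro i _ hij
    by_cases hci : c i = 0
    · simp [hci]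
    · rw [Polynomial.eval_prod, Finset.prod_eq_zero (i := i)]
      · simp
      · simp [hsdef, hij, hci]
      · simp
  · simp

theorem gauss_nonneg {m : Type*} [Fintype m] {n : ℕ} (x : m → EuclideanSpace ℝ (Fin n))
    (c : m → ℝ) (s : ℝ) :
    0 ≤ ∑ i, ∑ j, c i * c j * Real.exp (-(s * dist (x i) (x j)) ^ 2) := by
  have hG : (Matrix.of fun i j => 2 * s ^ 2 * inner ℝ (x i) (x j)).PosSemidef := by
    refine .of_dotProduct_mulVec_nonneg (by ext i j; simp [real_inner_comm]) fun c => ?_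
    rw [quad_eq]
    have : ∑ i, ∑ j, c i * c j * (Matrix.of fun i j => 2 * s ^ 2 * inner ℝ (x i) (x j)) i j
        = 2 * s ^ 2 * inner ℝ (∑ i, c i • x i) (∑ i, c i • x i) := by
      simp only [sum_inner, inner_sum, inner_smul_left, inner_smul_right, Finset.mul_sum,
        Matrix.of_apply]
      refine Finset.sum_congr rfl fun i _ => Finset.sum_congr rfl fun j _ => ?_
      simp [real_inner_comm]
      ring
    rw [this]
    exact mul_nonneg (by positivity) real_inner_self_nonneg
  have h := quad_exp_nonneg _ hG (fun i => c i * Real.exp (-(s * ‖x i‖) ^ 2))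
  refine h.trans_eq (Finset.sum_congr rfl fun i _ => Finset.sum_congr rfl fun j _ => ?_)
  have : -(s * dist (x i) (x j)) ^ 2 = -(s * ‖x i‖) ^ 2 + -(s * ‖x j‖) ^ 2
      + 2 * s ^ 2 * inner ℝ (x i) (x j) := by
    rw [dist_eq_norm, mul_pow, norm_sub_sq_real]; ring
  rw [this, Real.exp_add, Real.exp_add, Matrix.of_apply]
  ring

/-- The profile function. -/
noncomputable def prof (s : ℝ) : ℝ := (1 - Real.exp (-s ^ 2)) / s ^ 2

theorem prof_nonneg (s : ℝ) : 0 ≤ prof s := by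
  refine div_nonneg ?_ (sq_nonneg s)
  have : Real.exp (-s ^ 2) ≤ 1 := Real.exp_le_one_iff.2 (by nlinarith [sq_nonneg s])
  linarith

theorem prof_integrable : MeasureTheory.Integrable prof := by
  refine (integrable_inv_one_add_sq.const_mul 2).mono' ?_ (.of_forall fun s => ?_)
  · unfold prof
    exact Measurable.aestronglyMeasurable (by fun_prop)
  · rw [Real.norm_of_nonneg (prof_nonneg s)]
    rcases eq_or_ne s 0 with rfl | hs
    · simp [prof]
    · have hs2 : 0 < s ^ 2 := by positivity
      have h1 : 0 < Real.exp (-s ^ 2) := Real.exp_pos _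
      have h2 := Real.add_one_le_exp (-s ^ 2)
      unfold prof
      rw [← div_eq_mul_inv, div_le_div_iff₀ hs2 (by positivity)]
      rcases le_total (s ^ 2) 1 with h | h <;> nlinarith

theorem prof_integral_pos : 0 < ∫ s, prof s := by
  refine (MeasureTheory.integral_pos_iff_support_of_nonneg prof_nonneg prof_integrable).2 ?_
  have : Set.Ioi (0 : ℝ) ⊆ Function.support prof := by
    intro s hs
    have hs : 0 < s := hs
    have h : Real.exp (-s ^ 2) < 1 := Real.exp_zero ▸ Real.exp_lt_exp.2 (by nlinarith)
    have : 0 < prof s := div_pos (by linarith) (by positivity)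
    exact this.ne'
  exact lt_of_lt_of_le (by simp) (MeasureTheory.measure_mono this)

theorem prof_scale {r : ℝ} (hr : 0 ≤ r) :
    MeasureTheory.Integrable (fun s => (1 - Real.exp (-(s * r) ^ 2)) / s ^ 2) ∧
      ∫ s, (1 - Real.exp (-(s * r) ^ 2)) / s ^ 2 = r * ∫ s, prof s := by
  rcases hr.eq_or_lt with rfl | hr
  · simp
  · have he : (fun s => (1 - Real.exp (-(s * r) ^ 2)) / s ^ 2) = fun s => r ^ 2 * prof (s * r) := by
      funext s
      unfold prof
      rw [mul_pow]
      rcases eq_or_ne s 0 with rfl | hs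
      · simp
      · field_simp
    rw [he]
    refine ⟨(prof_integrable.comp_mul_right' hr.ne').const_mul _, ?_⟩
    rw [MeasureTheory.integral_const_mul, MeasureTheory.Measure.integral_comp_mul_right,
      abs_of_pos (inv_pos.2 hr), smul_eq_mul]
    field_simp

theorem dist_cnd {m : Type*} [Fintype m] {n : ℕ} (x : m → EuclideanSpace ℝ (Fin n))
    (c : m → ℝ) (hc : ∑ i, c i = 0) : ∑ i, ∑ j, c i * c j * dist (x i) (x j) ≤ 0 := by
  have key : (∑ i, ∑ j, c i * c j * dist (x i) (x j)) * ∫ s, prof s =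
      ∫ s, ∑ i, ∑ j, c i * c j * ((1 - Real.exp (-(s * dist (x i) (x j)) ^ 2)) / s ^ 2) := by
    have hint : ∀ i j, MeasureTheory.Integrable
        fun s => c i * c j * ((1 - Real.exp (-(s * dist (x i) (x j)) ^ 2)) / s ^ 2) :=
      fun i j => (prof_scale dist_nonneg).1.const_mul _
    rw [MeasureTheory.integral_finsetSum _
      fun i _ => MeasureTheory.integrable_finsetSum _ fun j _ => hint i j]
    rw [Finset.sum_mul]
    refine Finset.sum_congr rfl fun i _ => ?_
    rw [MeasureTheory.integral_finsetSum _ fun j _ => hint i j, Finset.sum_mul]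
    refine Finset.sum_congr rfl fun j _ => ?_
    rw [MeasureTheory.integral_const_mul, (prof_scale dist_nonneg).2, mul_assoc]
  have hle : ∫ s, ∑ i, ∑ j, c i * c j * ((1 - Real.exp (-(s * dist (x i) (x j)) ^ 2)) / s ^ 2)
      ≤ 0 := by
    refine MeasureTheory.integral_nonpos fun s => ?_
    have h1 : ∑ i, ∑ j, c i * c j = 0 := by rw [← Finset.sum_mul_sum, hc, zero_mul]
    have h2 := gauss_nonneg x c s
    have h3 : ∑ i, ∑ j, c i * c j * ((1 - Real.exp (-(s * dist (x i) (x j)) ^ 2)) / s ^ 2)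
        = (∑ i, ∑ j, c i * c j -
          ∑ i, ∑ j, c i * c j * Real.exp (-(s * dist (x i) (x j)) ^ 2)) / s ^ 2 := by
      simp only [← Finset.sum_sub_distrib, Finset.sum_div]
      refine Finset.sum_congr rfl fun i _ => Finset.sum_congr rfl fun j _ => by ring
    simp only [Pi.zero_apply]
    rw [h3, h1]
    exact div_nonpos_of_nonpos_of_nonneg (by linarith) (sq_nonneg s)
  rw [← key] at hle
  exact nonpos_of_mul_nonpos_left hle prof_integral_pos

theorem simMatrix_posDef {m : Type*} [Fintype m] {n : ℕ} (x : m → EuclideanSpace ℝ (Fin n))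
    (hx : Function.Injective x) : (simMatrix x).PosDef := by
  refine .of_dotProduct_mulVec_pos (by ext i j; simp [simMatrix, dist_comm]) fun c hc => ?_
  have hG : (Matrix.of fun i j => ‖x i‖ + ‖x j‖ - dist (x i) (x j)).PosSemidef := by
    refine .of_dotProduct_mulVec_nonneg (by ext i j; simp [dist_comm, add_comm]) fun c => ?_
    rw [quad_eq]
    have h := dist_cnd (fun o : Option m => o.elim 0 x) (fun o => o.elim (-∑ i, c i) c)
      (by simp [Fintype.sum_option])
    simp only [Fintype.sum_option, Option.elim, dist_zero_left, dist_zero_right] at h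
    simp only [Matrix.of_apply, mul_sub, mul_add, Finset.sum_add_distrib, Finset.sum_sub_distrib]
      at h ⊢
    have e1 : ∑ i, ∑ j, c i * c j * ‖x i‖ = (∑ j, c j) * ∑ i, c i * ‖x i‖ := by
      rw [mul_comm, Finset.sum_mul_sum]
      refine Finset.sum_congr rfl fun i _ => Finset.sum_congr rfl fun j _ => by ring
    have e2 : ∑ i, ∑ j, c i * c j * ‖x j‖ = (∑ j, c j) * ∑ i, c i * ‖x i‖ := by
      rw [Finset.sum_mul_sum]
      refine Finset.sum_congr rfl fun i _ => Finset.sum_congr rfl fun j _ => by ring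
    have e3 : ∑ i, (-∑ i, c i) * c i * ‖x i‖ = -((∑ j, c j) * ∑ i, c i * ‖x i‖) := by
      rw [← neg_mul, Finset.mul_sum]
      refine Finset.sum_congr rfl fun i _ => by ring
    have e4 : ∑ i, c i * (-∑ i, c i) * ‖x i‖ = -((∑ j, c j) * ∑ i, c i * ‖x i‖) := by
      rw [← neg_mul, Finset.mul_sum]
      refine Finset.sum_congr rfl fun i _ => by ring
    rw [e1, e2]
    rw [e3, e4, norm_zero] at h
    linarith
  have h := quad_exp_pos _ hG (by
      intro i j hij
      have : 0 < dist (x i) (x j) := dist_pos.2 (hx.ne hij)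
      simp only [Matrix.of_apply, dist_self]
      linarith) (fun i => c i * Real.exp (-‖x i‖)) (by
      obtain ⟨i, hi⟩ := Function.ne_iff.1 hc
      refine Function.ne_iff.2 ⟨i, ?_⟩
      simpa using hi)
  rw [quad_eq]
  refine h.trans_eq (Finset.sum_congr rfl fun i _ => Finset.sum_congr rfl fun j _ => ?_)
  have : -dist (x i) (x j) = -‖x i‖ + -‖x j‖ + (‖x i‖ + ‖x j‖ - dist (x i) (x j)) := by ring
  rw [simMatrix, Matrix.of_apply, Matrix.of_apply, this, Real.exp_add, Real.exp_add]
  ring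

/-- For a finite set `X` of distinct points of `ℝⁿ` with similarity matrix `A`, and a nonempty
proper subset `Y ⊆ X` (indexed by `P`, with `N_Y` points):
`0 < tr(A/A_{Y ᶜ}) < N_Y`. -/
theorem trace_schurCompl_bounds {N n : ℕ} (x : Fin N → EuclideanSpace ℝ (Fin n))
    (hx : Function.Injective x) (P : Finset (Fin N)) (hP : P.Nonempty)
    (hP' : P ≠ Finset.univ) :
    0 < (schurCompl (simMatrix x) P).trace ∧
      (schurCompl (simMatrix x) P).trace < (P.card : ℝ) := by
  set A := simMatrix x with hA
  have hPD : A.PosDef := simMatrix_posDef x hx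
  have hne : (Pᶜ).Nonempty := by
    rw [Finset.nonempty_iff_ne_empty, Ne, Finset.compl_eq_empty_iff]; exact hP'
  obtain ⟨k, hk⟩ := hne
  have : Nonempty ↥P := hP.to_subtype
  set B := A.submatrix ((↑) : ↥P → Fin N) ((↑) : ↥Pᶜ → Fin N) with hB
  set D := A.submatrix ((↑) : ↥Pᶜ → Fin N) ((↑) : ↥Pᶜ → Fin N) with hD
  have hDpd : D.PosDef := hPD.submatrix Subtype.coe_injective
  have hdet : IsUnit D.det := (Matrix.isUnit_iff_isUnit_det _).1 hDpd.isUnit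
  have hsymm : ∀ i j, A i j = A j i := by intro i j; simp [hA, simMatrix, dist_comm]
  have hentry : ∀ i : ↥P, schurCompl A P i i = 1 - B i ⬝ᵥ (D⁻¹ *ᵥ B i) := by
    intro i
    unfold schurCompl
    rw [Matrix.sub_apply, ← hB, ← hD]
    congr 1
    · simp [hA, simMatrix]
    · rw [Matrix.mul_assoc, Matrix.mul_apply_eq_vecMul]
      rfl
  have htr : (schurCompl A P).trace = ∑ i : ↥P, (1 - B i ⬝ᵥ (D⁻¹ *ᵥ B i)) := by
    rw [Matrix.trace]
    exact Finset.sum_congr rfl fun i _ => hentry i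
  rw [htr]
  constructor
  · refine Finset.sum_pos (fun i _ => ?_) Finset.univ_nonempty
    set w := D⁻¹ *ᵥ B i with hw
    have hDw : D *ᵥ w = B i := by
      rw [hw, Matrix.mulVec_mulVec, Matrix.mul_nonsing_inv _ hdet, Matrix.one_mulVec]
    let e : Option ↥Pᶜ → Fin N := fun o => o.elim (i : Fin N) (fun j => (j : Fin N))
    have he : Function.Injective e := by
      rintro (_ | a) (_ | b) h
      · rfl
      · exact absurd i.2 (by have := b.2; simp only [e, Option.elim] at h; rw [h]; exact Finset.mem_compl.1 this)
      · exact absurd i.2 (by have := a.2; simp only [e, Option.elim] at h; rw [← h]; exact Finset.mem_compl.1 this)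
      · simp only [e, Option.elim] at h
        rw [Subtype.ext h]
    have hq := (hPD.submatrix he).dotProduct_mulVec_pos
      (x := fun o => o.elim 1 (fun j => -w j)) (fun h => by simpa using congrFun h none)
    rw [quad_eq] at hq
    simp only [Fintype.sum_option, Option.elim, Matrix.submatrix_apply, e,
      Finset.sum_add_distrib] at hq
    have e0 : A i i = 1 := by simp [hA, simMatrix]
    have e1 : ∑ j : ↥Pᶜ, 1 * -w j * A i j = -(B i ⬝ᵥ w) := by
      rw [dotProduct, ← Finset.sum_neg_distrib]
      refine Finset.sum_congr rfl fun j _ => ?_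
      simp only [hB, Matrix.submatrix_apply]; ring
    have e2 : ∑ j : ↥Pᶜ, -w j * 1 * A j i = -(B i ⬝ᵥ w) := by
      rw [← e1]
      refine Finset.sum_congr rfl fun j _ => ?_
      rw [hsymm j i]; ring
    have e3 : ∑ j : ↥Pᶜ, ∑ l : ↥Pᶜ, -w j * -w l * A j l = B i ⬝ᵥ w := by
      rw [← hDw, dotProduct]
      refine Finset.sum_congr rfl fun j _ => ?_
      rw [mulVec, dotProduct, Finset.sum_mul]
      refine Finset.sum_congr rfl fun l _ => ?_
      simp only [hD, Matrix.submatrix_apply]; ring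
    rw [e0, e1, e2, e3] at hq
    linarith
  · have : (P.card : ℝ) = ∑ _i : ↥P, (1 : ℝ) := by simp
    rw [this]
    refine Finset.sum_lt_sum_of_nonempty Finset.univ_nonempty fun i _ => ?_
    have hb : B i ≠ 0 := by
      intro h
      have := congrFun h ⟨k, hk⟩
      simp [hB, hA, simMatrix] at this
    have := hDpd.inv.dotProduct_mulVec_pos hb
    rw [star_trivial] at this
    linarith
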